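/- (MALICE regret gap upper bound) There is a universal constant C such that in any finite Markov Game with deviation classes Φ, if the game is u-recoverable with respect to the expert σ_E, the expert satisfies β-coverage for some β > 0, and the learner σ satisfies the MALICE loss guarantee ℓ_MALICE(σ) = max_{i∈[m]} max_{φ_i∈Φ_i} E_{s∼d^{π_{σ_E}}}[(d^{π_{σ,φ_i}}(s) / d^{π_{σ_E}}(s)) · ℓ_TV(σ_E(s), σ(s))] ≤ ε, then the regret gap satisfies R_Φ(σ) − R_Φ(σ_E) ≤ C·ε·u·H. -/

import Mathlib

open scoped Classical

noncomputable section

namespace MAIL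

/-- A finite Markov Game: horizon `H`, transition kernel `T`, per-agent rewards `r`,
and initial state distribution `ρ₀`.  The agents are indexed by `Fin m`, the state
space is `S`, and agent `i` has action space `A i`; a joint action is an element of
`∀ i, A i`. -/
structure MG (m : ℕ) (S : Type) (A : Fin m → Type) where
  H : ℕ
  T : S → (∀ i, A i) → S → ℝ
  r : Fin m → S → (∀ i, A i) → ℝ
  ρ₀ : S → ℝ

variable {m : ℕ} {S : Type} {A : Fin m → Type} [Fintype S] [∀ i, Fintype (A i)]

/-- The Markov game data is valid: `ρ₀` and each `T s a` are probability
distributions, and all rewards take values in `[-1, 1]`. -/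
def IsMG (G : MG m S A) : Prop :=
  (∀ s, 0 ≤ G.ρ₀ s) ∧ (∑ s, G.ρ₀ s) = 1 ∧
  (∀ s a, (∀ s', 0 ≤ G.T s a s') ∧ (∑ s', G.T s a s') = 1) ∧
  (∀ i s a, |G.r i s a| ≤ 1)

/-- A (mediator or joint) policy is a stochastic map from states to joint actions.
When all agents obediently follow the mediator policy `σ`, the induced joint policy
`π_σ` is `σ` itself. -/
def IsPolicy (π : S → (∀ i, A i) → ℝ) : Prop :=
  ∀ s, (∀ a, 0 ≤ π s a) ∧ (∑ a, π s a) = 1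

/-- Distribution over states at (0-indexed) step `h` under joint policy `π`. -/
def stateDist (G : MG m S A) (π : S → (∀ i, A i) → ℝ) : ℕ → S → ℝ
  | 0 => G.ρ₀
  | h + 1 => fun s' => ∑ s, ∑ a, stateDist G π h s * π s a * G.T s a s'

/-- Expected cumulative reward over horizon `G.H` of joint policy `π` when every
agent's reward function is `f`, i.e. `J(π, f)`. -/
def Jf (G : MG m S A) (π : S → (∀ i, A i) → ℝ) (f : S → (∀ i, A i) → ℝ) : ℝ :=
  ∑ h ∈ Finset.range G.H, ∑ s, ∑ a, stateDist G π h s * π s a * f s a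

/-- Value `J_i(π)` of joint policy `π` for agent `i` under the true rewards. -/
def J (G : MG m S A) (i : Fin m) (π : S → (∀ i, A i) → ℝ) : ℝ :=
  Jf G π (G.r i)

/-- Occupancy measure `ρ^π(s, a) = (1/H) ∑_h Pr_π(s_h = s, a_h = a)`. -/
def occ (G : MG m S A) (π : S → (∀ i, A i) → ℝ) (s : S) (a : ∀ i, A i) : ℝ :=
  (∑ h ∈ Finset.range G.H, stateDist G π h s * π s a) / G.H

/-- Average state visitation distribution `d^π(s) = ∑_a ρ^π(s, a)`. -/
def dAvg (G : MG m S A) (π : S → (∀ i, A i) → ℝ) (s : S) : ℝ :=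
  ∑ a, occ G π s a

/-- The joint policy `π_{σ, φ_i}` obtained from mediator policy `σ` when agent `i`
deviates via `φ : S → A i → A i` (playing `φ s a` when recommended `a` at state `s`)
while all other agents follow their recommendations. -/
def dev (σ : S → (∀ i, A i) → ℝ) (i : Fin m) (φ : S → A i → A i) :
    S → (∀ i, A i) → ℝ :=
  fun s b => ∑ a : ∀ j, A j, if Function.update a i (φ s (a i)) = b then σ s a else 0

/-- Regret `R_Φ(σ, f)` of mediator policy `σ` w.r.t. deviation classes `Φ`, when
`f` is used as every agent's reward function. -/
def regretF (G : MG m S A) (σ : S → (∀ i, A i) → ℝ)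
    (Φ : ∀ i : Fin m, Set (S → A i → A i)) (f : S → (∀ i, A i) → ℝ) : ℝ :=
  ⨆ i : Fin m, ⨆ φ : Φ i, (Jf G (dev σ i φ.1) f - Jf G σ f)

/-- Regret `R_Φ(σ)` of mediator policy `σ` under the true rewards. -/
def regret (G : MG m S A) (σ : S → (∀ i, A i) → ℝ)
    (Φ : ∀ i : Fin m, Set (S → A i → A i)) : ℝ :=
  ⨆ i : Fin m, ⨆ φ : Φ i, (J G i (dev σ i φ.1) - J G i σ)

/-- Value-to-go `V` of joint policy `π` with `k` steps remaining (so the value from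
step `h` in the paper corresponds to `k = H - h` remaining steps), with every
agent's reward given by `f`. -/
def Vgo (G : MG m S A) (f : S → (∀ i, A i) → ℝ) (π : S → (∀ i, A i) → ℝ) :
    ℕ → S → ℝ
  | 0 => fun _ => 0
  | k + 1 => fun s => ∑ a, π s a * (f s a + ∑ s', G.T s a s' * Vgo G f π k s')

/-- Q-value of joint policy `π` with `k` steps remaining. -/
def Qgo (G : MG m S A) (f : S → (∀ i, A i) → ℝ) (π : S → (∀ i, A i) → ℝ)
    (k : ℕ) (s : S) (a : ∀ i, A i) : ℝ :=
  match k with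
  | 0 => 0
  | k + 1 => f s a + ∑ s', G.T s a s' * Vgo G f π k s'

/-- Advantage `A = Q - V` of joint policy `π` with `k` steps remaining. -/
def Adv (G : MG m S A) (f : S → (∀ i, A i) → ℝ) (π : S → (∀ i, A i) → ℝ)
    (k : ℕ) (s : S) (a : ∀ i, A i) : ℝ :=
  Qgo G f π k s a - Vgo G f π k s

/-- `u`-recoverability: the advantage of any expert-plus-single-deviation joint
policy `π_{σ_E, φ_i}` is bounded by `u` at every state, joint action, and step. -/
def Recoverable (G : MG m S A) (Φ : ∀ i : Fin m, Set (S → A i → A i))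
    (σE : S → (∀ i, A i) → ℝ) (u : ℝ) : Prop :=
  ∀ i : Fin m, ∀ φ ∈ Φ i, ∀ k ≤ G.H, ∀ s a, |Adv G (G.r i) (dev σE i φ) k s a| ≤ u

/-- `β`-coverage: the expert's average state distribution puts mass at least `β`
on every state. -/
def Coverage (G : MG m S A) (σE : S → (∀ i, A i) → ℝ) (β : ℝ) : Prop :=
  ∀ s, β ≤ dAvg G σE s

/-- Total variation distance between two finitely supported distributions. -/
def tv {α : Type} [Fintype α] (p q : α → ℝ) : ℝ :=
  (∑ a, |p a - q a|) / 2

theorem dev_id (σ : S → (∀ i, A i) → ℝ) (i : Fin m) :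
    dev σ i (fun _ a => a) = σ := by
  funext s b
  simp [dev, Function.update_eq_self]

theorem IsPolicy.dev {σ : S → (∀ i, A i) → ℝ} (hσ : IsPolicy σ) (i : Fin m)
    (φ : S → A i → A i) : IsPolicy (dev σ i φ) := by
  intro s
  refine ⟨fun b => Finset.sum_nonneg fun a _ => ?_, ?_⟩
  · split_ifs
    · exact (hσ s).1 a
    · exact le_rfl
  · simp only [MAIL.dev]
    rw [Finset.sum_comm]
    simpa using (hσ s).2

/-- A strategy deviation does not increase the `ℓ¹` distance between mediators. -/
theorem sum_abs_dev_sub_le (σ τ : S → (∀ i, A i) → ℝ) (i : Fin m)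
    (φ : S → A i → A i) (s : S) :
    ∑ b, |dev σ i φ s b - dev τ i φ s b| ≤ ∑ a, |σ s a - τ s a| := by
  calc ∑ b, |dev σ i φ s b - dev τ i φ s b|
      ≤ ∑ b, ∑ a : ∀ j, A j,
          if Function.update a i (φ s (a i)) = b then |σ s a - τ s a| else 0 := by
        refine Finset.sum_le_sum fun b _ => ?_
        simp only [dev]
        rw [← Finset.sum_sub_distrib]
        refine (Finset.abs_sum_le_sum_abs _ _).trans (Finset.sum_le_sum fun a _ => ?_)
        split_ifs <;> simp
    _ = ∑ a, |σ s a - τ s a| := by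
        rw [Finset.sum_comm]
        simp

theorem stateDist_nonneg {G : MG m S A} (hG : IsMG G) {π : S → (∀ i, A i) → ℝ}
    (hπ : IsPolicy π) (h : ℕ) (s : S) : 0 ≤ stateDist G π h s := by
  induction h generalizing s with
  | zero => exact hG.1 s
  | succ h ih =>
    exact Finset.sum_nonneg fun s' _ => Finset.sum_nonneg fun a _ =>
      mul_nonneg (mul_nonneg (ih s') ((hπ s').1 a)) ((hG.2.2.1 s' a).1 s)

theorem dAvg_eq (G : MG m S A) {π : S → (∀ i, A i) → ℝ} (hπ : IsPolicy π) (s : S) :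
    dAvg G π s = (∑ h ∈ Finset.range G.H, stateDist G π h s) / G.H := by
  simp only [dAvg, occ]
  rw [← Finset.sum_div, Finset.sum_comm]
  simp only [← Finset.mul_sum, (hπ s).2, mul_one]

theorem sum_stateDist_mul_adv (G : MG m S A) (f : S → (∀ i, A i) → ℝ)
    {π : S → (∀ i, A i) → ℝ} (π' : S → (∀ i, A i) → ℝ) (hπ : IsPolicy π) (h k : ℕ) :
    ∑ s, ∑ a, stateDist G π h s * π s a * Adv G f π' (k + 1) s a =
      ∑ s, ∑ a, stateDist G π h s * π s a * f s a
        - (∑ s, stateDist G π h s * Vgo G f π' (k + 1) s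
          - ∑ s, stateDist G π (h + 1) s * Vgo G f π' k s) := by
  have h1 : ∑ s, stateDist G π (h + 1) s * Vgo G f π' k s =
      ∑ s, ∑ a, stateDist G π h s * π s a * ∑ s', G.T s a s' * Vgo G f π' k s' := by
    simp only [stateDist, Finset.sum_mul, Finset.mul_sum]
    rw [Finset.sum_comm]
    refine Finset.sum_congr rfl fun s _ => ?_
    rw [Finset.sum_comm]
    simp only [mul_assoc]
  have h2 : ∑ s, stateDist G π h s * Vgo G f π' (k + 1) s =
      ∑ s, ∑ a, stateDist G π h s * π s a * Vgo G f π' (k + 1) s := by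
    refine Finset.sum_congr rfl fun s _ => ?_
    rw [← Finset.sum_mul, ← Finset.mul_sum, (hπ s).2, mul_one]
  rw [h1, h2]
  simp only [← Finset.sum_sub_distrib]
  refine Finset.sum_congr rfl fun s _ => Finset.sum_congr rfl fun a _ => ?_
  simp only [Adv, Qgo]
  ring

theorem sum_stateDist_mul_adv_range (G : MG m S A) (f : S → (∀ i, A i) → ℝ)
    {π : S → (∀ i, A i) → ℝ} (π' : S → (∀ i, A i) → ℝ) (hπ : IsPolicy π) :
    ∑ h ∈ Finset.range G.H, ∑ s, ∑ a,
        stateDist G π h s * π s a * Adv G f π' (G.H - h) s a =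
      Jf G π f - ∑ s, G.ρ₀ s * Vgo G f π' G.H s := by
  have hstep : ∀ h ∈ Finset.range G.H,
      ∑ s, ∑ a, stateDist G π h s * π s a * Adv G f π' (G.H - h) s a =
        ∑ s, ∑ a, stateDist G π h s * π s a * f s a
          - (∑ s, stateDist G π h s * Vgo G f π' (G.H - h) s
            - ∑ s, stateDist G π (h + 1) s * Vgo G f π' (G.H - (h + 1)) s) := by
    intro h hh
    have hk : G.H - h = G.H - (h + 1) + 1 := by
      have := Finset.mem_range.1 hh
      omega
    rw [hk]
    exact sum_stateDist_mul_adv G f π' hπ h _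
  rw [Finset.sum_congr rfl hstep, Finset.sum_sub_distrib,
    Finset.sum_range_sub' (fun h => ∑ s, stateDist G π h s * Vgo G f π' (G.H - h) s)]
  simp [Jf, stateDist, Vgo]

theorem sum_policy_mul_adv (G : MG m S A) (f : S → (∀ i, A i) → ℝ)
    {π : S → (∀ i, A i) → ℝ} (hπ : IsPolicy π) (k : ℕ) (s : S) :
    ∑ a, π s a * Adv G f π k s a = 0 := by
  cases k with
  | zero => simp [Adv, Qgo, Vgo]
  | succ k =>
    simp only [Adv, mul_sub]
    rw [Finset.sum_sub_distrib, ← Finset.sum_mul, (hπ s).2, one_mul]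
    simp [Qgo, Vgo]

theorem Jf_eq_sum_Vgo (G : MG m S A) (f : S → (∀ i, A i) → ℝ)
    {π : S → (∀ i, A i) → ℝ} (hπ : IsPolicy π) :
    Jf G π f = ∑ s, G.ρ₀ s * Vgo G f π G.H s := by
  refine sub_eq_zero.1 ?_
  rw [← sum_stateDist_mul_adv_range G f π hπ]
  refine Finset.sum_eq_zero fun h _ => Finset.sum_eq_zero fun s _ => ?_
  simp only [mul_assoc]
  rw [← Finset.mul_sum, sum_policy_mul_adv G f hπ, mul_zero]

/-- The performance difference lemma. -/
theorem Jf_sub_Jf (G : MG m S A) (f : S → (∀ i, A i) → ℝ)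
    {π π' : S → (∀ i, A i) → ℝ} (hπ : IsPolicy π) (hπ' : IsPolicy π') :
    Jf G π f - Jf G π' f =
      ∑ h ∈ Finset.range G.H, ∑ s, stateDist G π h s *
        ∑ a, (π s a - π' s a) * Adv G f π' (G.H - h) s a := by
  rw [Jf_eq_sum_Vgo G f hπ', ← sum_stateDist_mul_adv_range G f π' hπ]
  refine Finset.sum_congr rfl fun h _ => Finset.sum_congr rfl fun s _ => ?_
  simp only [sub_mul, mul_assoc]
  rw [Finset.sum_sub_distrib, sum_policy_mul_adv G f hπ', sub_zero, Finset.mul_sum]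

theorem abs_Jf_sub_Jf_le {G : MG m S A} (hG : IsMG G) (hH : G.H ≠ 0)
    (f : S → (∀ i, A i) → ℝ) {π π' : S → (∀ i, A i) → ℝ} (hπ : IsPolicy π)
    (hπ' : IsPolicy π') {u : ℝ} (hu : ∀ k ≤ G.H, ∀ s a, |Adv G f π' k s a| ≤ u) :
    |Jf G π f - Jf G π' f| ≤
      u * G.H * ∑ s, dAvg G π s * ∑ a, |π s a - π' s a| := by
  have hH' : (G.H : ℝ) ≠ 0 := Nat.cast_ne_zero.2 hH
  have hrhs : u * G.H * ∑ s, dAvg G π s * ∑ a, |π s a - π' s a| =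
      ∑ h ∈ Finset.range G.H, ∑ s, stateDist G π h s *
        ((∑ a, |π s a - π' s a|) * u) := by
    rw [Finset.sum_comm, Finset.mul_sum]
    refine Finset.sum_congr rfl fun s _ => ?_
    rw [dAvg_eq G hπ, ← Finset.sum_mul]
    field_simp
  rw [Jf_sub_Jf G f hπ hπ', hrhs]
  refine (Finset.abs_sum_le_sum_abs _ _).trans (Finset.sum_le_sum fun h _ => ?_)
  refine (Finset.abs_sum_le_sum_abs _ _).trans (Finset.sum_le_sum fun s _ => ?_)
  rw [abs_mul, abs_of_nonneg (stateDist_nonneg hG hπ h s), Finset.sum_mul]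
  refine mul_le_mul_of_nonneg_left ?_ (stateDist_nonneg hG hπ h s)
  refine (Finset.abs_sum_le_sum_abs _ _).trans (Finset.sum_le_sum fun a _ => ?_)
  rw [abs_mul]
  exact mul_le_mul_of_nonneg_left (hu _ (Nat.sub_le _ _) s a) (abs_nonneg _)

/-- Deviating from the learner instead of the expert changes a value by at most the
MALICE loss of the deviation, scaled by `2 * u * H`. -/
theorem abs_J_dev_sub_le {G : MG m S A} (hG : IsMG G)
    {Φ : ∀ i : Fin m, Set (S → A i → A i)} {σE σ : S → (∀ i, A i) → ℝ}
    (hσE : IsPolicy σE) (hσ : IsPolicy σ) {u β ε : ℝ} (hu : Recoverable G Φ σE u)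
    (hβ : 0 < β) (hcov : Coverage G σE β) {i : Fin m} {φ : S → A i → A i} (hφ : φ ∈ Φ i)
    (hε : ∑ s, dAvg G σE s *
      (dAvg G (dev σ i φ) s / dAvg G σE s * tv (σE s) (σ s)) ≤ ε) :
    |J G i (dev σ i φ) - J G i (dev σE i φ)| ≤ 2 * ε * u * G.H := by
  have hd : ∀ s, dAvg G σE s ≠ 0 := fun s => (hβ.trans_le (hcov s)).ne'
  obtain ⟨s₀⟩ : Nonempty S := by
    by_contra hS
    rw [not_nonempty_iff] at hS
    simpa using hG.2.1
  obtain ⟨a₀⟩ : Nonempty (∀ i, A i) := by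
    by_contra hA
    rw [not_nonempty_iff] at hA
    simpa using (hσ s₀).2
  have hu0 : 0 ≤ u := (abs_nonneg _).trans (hu i φ hφ 0 (Nat.zero_le _) s₀ a₀)
  have hH : G.H ≠ 0 := by
    intro hH
    exact hd s₀ (by simp [dAvg, occ, hH])
  refine (abs_Jf_sub_Jf_le hG hH (G.r i) (hσ.dev i φ) (hσE.dev i φ) (hu i φ hφ)).trans ?_
  have hsum : ∑ s, dAvg G (dev σ i φ) s * ∑ b, |dev σ i φ s b - dev σE i φ s b| ≤ 2 * ε := by
    refine le_trans ?_ (mul_le_mul_of_nonneg_left hε zero_le_two)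
    rw [Finset.mul_sum]
    refine Finset.sum_le_sum fun s _ => ?_
    have hnn : 0 ≤ dAvg G (dev σ i φ) s := by
      rw [dAvg_eq G (hσ.dev i φ)]
      exact div_nonneg (Finset.sum_nonneg fun h _ => stateDist_nonneg hG (hσ.dev i φ) h s)
        (Nat.cast_nonneg _)
    refine (mul_le_mul_of_nonneg_left (sum_abs_dev_sub_le σ σE i φ s) hnn).trans_eq ?_
    have hd' := hd s
    simp only [tv, abs_sub_comm (σE s _)]
    field_simp
  calc u * G.H * ∑ s, dAvg G (dev σ i φ) s * ∑ b, |dev σ i φ s b - dev σE i φ s b|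
      ≤ u * G.H * (2 * ε) := mul_le_mul_of_nonneg_left hsum (by positivity)
    _ = 2 * ε * u * G.H := by ring

theorem le_regret (G : MG m S A) (σ : S → (∀ i, A i) → ℝ)
    (Φ : ∀ i : Fin m, Set (S → A i → A i)) {i : Fin m} {φ : S → A i → A i} (hφ : φ ∈ Φ i) :
    J G i (dev σ i φ) - J G i σ ≤ regret G σ Φ := by
  refine le_trans ?_ (le_ciSup (Set.finite_range fun i : Fin m =>
    ⨆ φ : Φ i, (J G i (dev σ i φ.1) - J G i σ)).bddAbove i)
  exact le_ciSup (f := fun φ : Φ i => J G i (dev σ i φ.1) - J G i σ)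
    (Set.finite_range _).bddAbove ⟨φ, hφ⟩

/-- **MALICE regret gap upper bound.** There is a universal constant
`C` such that in any `u`-recoverable finite Markov Game whose expert satisfies
`β`-coverage for some `β > 0`, a MALICE loss guarantee of `ε` implies a regret gap
of at most `C·ε·u·H`. -/
theorem malice_regret_gap_upper_bound :
    ∃ C : ℝ, 0 < C ∧
      ∀ (m : ℕ) (S : Type) (A : Fin m → Type) [Fintype S] [∀ i, Fintype (A i)]
        (G : MG m S A), IsMG G → 0 < m →
        ∀ (Φ : ∀ i : Fin m, Set (S → A i → A i)),
        (∀ i : Fin m, (fun (_ : S) (a : A i) => a) ∈ Φ i) →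
        ∀ (σE σ : S → (∀ i, A i) → ℝ), IsPolicy σE → IsPolicy σ →
        ∀ (u β ε : ℝ), Recoverable G Φ σE u → 0 < β → Coverage G σE β →
        (∀ i : Fin m, ∀ φ ∈ Φ i,
          (∑ s, dAvg G σE s * (dAvg G (dev σ i φ) s / dAvg G σE s * tv (σE s) (σ s))) ≤ ε) →
        regret G σ Φ - regret G σE Φ ≤ C * ε * u * G.H := by
  refine ⟨4, by norm_num, ?_⟩
  intro m S A _ _ G hG hm Φ hid σE σ hσE hσ u β ε hu hβ hcov hε
  have : Nonempty (Fin m) := ⟨⟨0, hm⟩⟩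
  rw [sub_le_iff_le_add]
  refine ciSup_le fun i => ?_
  have : Nonempty (Φ i) := ⟨⟨_, hid i⟩⟩
  refine ciSup_le fun φ => ?_
  have hdev := abs_J_dev_sub_le hG hσE hσ hu hβ hcov φ.2 (hε i φ.1 φ.2)
  have hobey := abs_J_dev_sub_le hG hσE hσ hu hβ hcov (hid i) (hε i _ (hid i))
  rw [dev_id, dev_id] at hobey
  have hreg := le_regret G σE Φ φ.2
  have h1 := (abs_le.1 hdev).2
  have h2 := (abs_le.1 hobey).1
  linarith

end MAIL
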